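/- arXiv:2211.13241 — 3 statements merged into one kernel-verified Lean document; each statement's English description precedes it below -/
import Mathlib

section
/- Let g be an invertible symmetric n×n real matrix and B an antisymmetric n×n real matrix. Then the 2n×2n block matrix H = [[g − B g⁻¹ B, −B g⁻¹], [g⁻¹ B, g⁻¹]] is symmetric and satisfies H η⁻¹ H = η; that is, the generalised metric built from a metric g and a B-field B is a symmetric element of O(n,n). -/
open Matrix

/-- The O(n,n)-invariant pairing η = [[0, Iₙ], [Iₙ, 0]] of generalised geometry. -/
def genEta (n : ℕ) : Matrix (Fin n ⊕ Fin n) (Fin n ⊕ Fin n) ℝ :=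
  Matrix.fromBlocks 0 1 1 0

theorem genEta_inv (n : ℕ) : (genEta n)⁻¹ = genEta n := by
  apply Matrix.inv_eq_left_inv
  simp [genEta, Matrix.fromBlocks_multiply]

/-- The generalised metric built from an invertible symmetric metric `g` and an
antisymmetric B-field `B` is a symmetric element of O(n,n):
`H = [[g − B g⁻¹ B, −B g⁻¹], [g⁻¹ B, g⁻¹]]` satisfies `Hᵀ = H` and `H η⁻¹ H = η`. -/
theorem generalised_metric_symmetric_and_in_Onn {n : ℕ}
    (g B : Matrix (Fin n) (Fin n) ℝ)
    (hg_symm : gᵀ = g) (hg_inv : IsUnit g.det) (hB_anti : Bᵀ = -B) :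
    let H : Matrix (Fin n ⊕ Fin n) (Fin n ⊕ Fin n) ℝ :=
      Matrix.fromBlocks (g - B * g⁻¹ * B) (-(B * g⁻¹)) (g⁻¹ * B) g⁻¹
    Hᵀ = H ∧ H * (genEta n)⁻¹ * H = genEta n := by
  intro H
  have h₁ : g * g⁻¹ = 1 := Matrix.mul_nonsing_inv g hg_inv
  have h₂ : g⁻¹ * g = 1 := Matrix.nonsing_inv_mul g hg_inv
  have h₃ : (g⁻¹)ᵀ = g⁻¹ := by rw [Matrix.transpose_nonsing_inv, hg_symm]
  refine ⟨?_, ?_⟩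
  · simp [H, Matrix.fromBlocks_transpose, Matrix.transpose_mul, hg_symm, hB_anti, h₃,
      Matrix.mul_assoc]
  · rw [genEta_inv]
    simp only [H, genEta, Matrix.fromBlocks_multiply, mul_zero, mul_one, zero_add, add_zero]
    congr 1
    · simp [mul_sub, sub_mul, mul_assoc, h₂, mul_nonsing_inv_cancel_left _ _ hg_inv]
    · simp [sub_mul, mul_assoc, h₁]
    · simp [mul_sub, mul_assoc, h₂]
    · simp [mul_assoc]
end

section
/- Let H be a symmetric 2n×2n real matrix satisfying H η⁻¹ H = η whose lower-right n×n block is invertible. Then there exist a unique invertible symmetric n×n real matrix g and a unique antisymmetric n×n real matrix B such that H = [[g − B g⁻¹ B, −B g⁻¹], [g⁻¹ B, g⁻¹]]. (Every generalised metric with invertible lower-right block admits a unique parameterisation in terms of a metric g and a B-field B.) -/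
open Matrix

/-- Every generalised metric (symmetric `H` with `H η⁻¹ H = η`) whose lower-right
n×n block is invertible admits a unique parameterisation in terms of an invertible
symmetric metric `g` and an antisymmetric B-field `B`:
`H = [[g − B g⁻¹ B, −B g⁻¹], [g⁻¹ B, g⁻¹]]`. -/
theorem generalised_metric_unique_parameterisation {n : ℕ}
    (H : Matrix (Fin n ⊕ Fin n) (Fin n ⊕ Fin n) ℝ)
    (hsymm : Hᵀ = H)
    (hO : H * (genEta n)⁻¹ * H = genEta n)
    (hblock : IsUnit (H.toBlocks₂₂).det) :
    ∃! p : Matrix (Fin n) (Fin n) ℝ × Matrix (Fin n) (Fin n) ℝ,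
      p.1ᵀ = p.1 ∧ IsUnit p.1.det ∧ p.2ᵀ = -p.2 ∧
        H = Matrix.fromBlocks (p.1 - p.2 * p.1⁻¹ * p.2) (-(p.2 * p.1⁻¹))
              (p.1⁻¹ * p.2) p.1⁻¹ := by
  obtain ⟨a, b, c, d, rfl⟩ : ∃ a b c d, H = Matrix.fromBlocks a b c d :=
    ⟨_, _, _, _, (Matrix.fromBlocks_toBlocks H).symm⟩
  rw [Matrix.toBlocks_fromBlocks₂₂] at hblock
  rw [Matrix.fromBlocks_transpose, Matrix.fromBlocks_inj] at hsymm
  obtain ⟨-, hcb, -, hd⟩ := hsymm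
  rw [genEta_inv, genEta, Matrix.fromBlocks_multiply, Matrix.fromBlocks_multiply,
    Matrix.fromBlocks_inj] at hO
  simp only [mul_zero, mul_one, zero_add, add_zero] at hO
  obtain ⟨-, -, hda, hdb⟩ := hO
  have hb : d⁻¹ * c * d = -b := by
    rw [mul_assoc, ← neg_eq_of_add_eq_zero_right hdb, mul_neg,
      Matrix.nonsing_inv_mul_cancel_left _ _ hblock]
  have hinv : IsUnit d⁻¹.det := Matrix.isUnit_nonsing_inv_det d hblock
  refine ⟨(d⁻¹, d⁻¹ * c), ⟨?_, hinv, ?_, ?_⟩, ?_⟩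
  · rw [Matrix.transpose_nonsing_inv, hd]
  · rw [Matrix.transpose_mul, hcb, Matrix.transpose_nonsing_inv, hd, ← neg_eq_iff_eq_neg.mpr hb,
      neg_mul, Matrix.mul_nonsing_inv_cancel_right _ _ hblock]
  · simp only [Matrix.nonsing_inv_nonsing_inv d hblock]
    rw [Matrix.fromBlocks_inj, hb, neg_neg, Matrix.mul_nonsing_inv_cancel_left _ _ hblock]
    refine ⟨?_, rfl, rfl, rfl⟩
    calc a = d⁻¹ * (1 - c * c) := by
          rw [← hda, add_sub_cancel_right, Matrix.nonsing_inv_mul_cancel_left _ _ hblock]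
      _ = d⁻¹ - d⁻¹ * c * (d * (d⁻¹ * c)) := by
          rw [Matrix.mul_nonsing_inv_cancel_left _ _ hblock, mul_sub, mul_one, mul_assoc]
      _ = d⁻¹ - -b * (d⁻¹ * c) := by rw [← mul_assoc, hb]
  · rintro ⟨g, B⟩ ⟨-, hg, -, hH⟩
    obtain ⟨-, -, rfl, rfl⟩ := Matrix.fromBlocks_inj.mp hH
    simp only [Matrix.nonsing_inv_nonsing_inv g hg, Matrix.mul_nonsing_inv_cancel_left _ _ hg]
end

section
/- Let ι be a finite index type, g : ι³ → ℝ antisymmetric in its first two arguments, k : ι⁴ → ℝ, and h : ι⁵ → ℝ a tensor satisfying h(A,B,C,D,E) = −h(A,D,E,B,C) for all indices. Suppose the Bianchi identity holds: for all A,B,C,D,E, the antisymmetrization over (A,B,C) of h(A,B,C,D,E) equals the antisymmetrization over (A,B,C) of Σ_F g(A,B,F) k(F,C,D,E). Then the total antisymmetrization over all five indices (A,B,C,D,E) of Σ_F g(A,B,F) k(F,C,D,E) vanishes. -/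
open Equiv in
/-- Permuting the arguments of a tensor by `τ` multiplies its antisymmetrization by `sign τ`. -/
theorem sum_sign_mul_comp_mul {n ι : Type*} [Fintype n] [DecidableEq n] (T : (n → ι) → ℝ)
    (X : n → ι) (τ : Perm n) :
    ∑ σ : Perm n, ((Perm.sign σ : ℤ) : ℝ) * T (X ∘ ⇑σ ∘ ⇑τ) =
      ((Perm.sign τ : ℤ) : ℝ) * ∑ σ : Perm n, ((Perm.sign σ : ℤ) : ℝ) * T (X ∘ ⇑σ) := by
  rw [← Equiv.sum_comp (Equiv.mulRight τ) (fun σ : Perm n => ((Perm.sign σ : ℤ) : ℝ) * T (X ∘ ⇑σ)),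
    Finset.mul_sum]
  refine Finset.sum_congr rfl fun σ _ => ?_
  have hτ : ((Perm.sign τ : ℤ) : ℝ) * ((Perm.sign τ : ℤ) : ℝ) = 1 := by
    exact_mod_cast Int.units_coe_mul_self (Perm.sign τ)
  simp only [Equiv.coe_mulRight, Perm.sign_mul, Perm.coe_mul, Units.val_mul, Int.cast_mul]
  linear_combination (-((Perm.sign σ : ℤ) : ℝ) * T (X ∘ ⇑σ ∘ ⇑τ)) * hτ

open Equiv in
/-- Antisymmetrizing first over the arguments in the range of an embedding `e : m ↪ n` and then over
all arguments is `|m|!` times the total antisymmetrization. -/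
theorem sum_sign_mul_sum_viaFintypeEmbedding {m n ι : Type*} [Fintype m] [DecidableEq m]
    [Fintype n] [DecidableEq n] (e : m ↪ n) (T : (n → ι) → ℝ) (X : n → ι) :
    ∑ σ : Perm n, ((Perm.sign σ : ℤ) : ℝ) * ∑ τ : Perm m, ((Perm.sign τ : ℤ) : ℝ) *
        T (X ∘ ⇑σ ∘ ⇑(τ.viaFintypeEmbedding e)) =
      Fintype.card (Perm m) * ∑ σ : Perm n, ((Perm.sign σ : ℤ) : ℝ) * T (X ∘ ⇑σ) := by
  simp_rw [Finset.mul_sum (s := (Finset.univ : Finset (Perm m))), mul_left_comm]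
  rw [Finset.sum_comm]
  have hτ (τ : Perm m) : ((Perm.sign τ : ℤ) : ℝ) * ((Perm.sign τ : ℤ) : ℝ) = 1 := by
    exact_mod_cast Int.units_coe_mul_self (Perm.sign τ)
  simp_rw [← Finset.mul_sum, sum_sign_mul_comp_mul, Perm.viaFintypeEmbedding_sign, ← mul_assoc, hτ]
  simp

/-- Antisymmetrizing a five-index tensor first over its first three arguments and then over all five
is `3!` times the total antisymmetrization. -/
theorem sum_sign_mul_sum_sign_fin_three {ι : Type*} (T : ι → ι → ι → ι → ι → ℝ) (X : Fin 5 → ι) :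
    ∑ σ : Equiv.Perm (Fin 5), ((Equiv.Perm.sign σ : ℤ) : ℝ) *
        ∑ τ : Equiv.Perm (Fin 3), ((Equiv.Perm.sign τ : ℤ) : ℝ) *
          T (![X (σ 0), X (σ 1), X (σ 2)] (τ 0)) (![X (σ 0), X (σ 1), X (σ 2)] (τ 1))
            (![X (σ 0), X (σ 1), X (σ 2)] (τ 2)) (X (σ 3)) (X (σ 4)) =
      6 * ∑ σ : Equiv.Perm (Fin 5), ((Equiv.Perm.sign σ : ℤ) : ℝ) *
        T (X (σ 0)) (X (σ 1)) (X (σ 2)) (X (σ 3)) (X (σ 4)) := by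
  let e : Fin 3 ↪ Fin 5 := Fin.castLEEmb (by decide)
  have key := sum_sign_mul_sum_viaFintypeEmbedding e
    (fun Y => T (Y 0) (Y 1) (Y 2) (Y 3) (Y 4)) X
  have hcard : (Fintype.card (Equiv.Perm (Fin 3)) : ℝ) = 6 := by
    rw [Fintype.card_perm, Fintype.card_fin]
    norm_num [Nat.factorial]
  rw [hcard] at key
  refine Eq.trans ?_ key
  refine Finset.sum_congr rfl fun σ _ => congrArg _ (Finset.sum_congr rfl fun τ _ => ?_)
  have hvec (i : Fin 3) : ![X (σ 0), X (σ 1), X (σ 2)] i = X (σ (e i)) := by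
    fin_cases i <;> rfl
  have hlow (i : Fin 3) : τ.viaFintypeEmbedding e (e i) = e (τ i) :=
    Equiv.Perm.viaFintypeEmbedding_apply_image τ e i
  have hhigh (j : Fin 5) (hj : 3 ≤ j.val) : τ.viaFintypeEmbedding e j = j := by
    refine Equiv.Perm.viaFintypeEmbedding_apply_notMem_range τ e ?_
    rintro ⟨i, rfl⟩
    exact absurd i.isLt (not_lt.mpr hj)
  simp only [Function.comp_apply, hvec, ← hlow, hhigh 3 (by decide), hhigh 4 (by decide)]
  rfl

/-- A five-index tensor that changes sign when its last two pairs of arguments are exchanged has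
vanishing total antisymmetrization. -/
theorem sum_sign_mul_eq_zero_of_pair_antisymm {ι : Type*} (h : ι → ι → ι → ι → ι → ℝ)
    (hpair : ∀ A B C D E, h A B C D E = -h A D E B C) (X : Fin 5 → ι) :
    ∑ σ : Equiv.Perm (Fin 5), ((Equiv.Perm.sign σ : ℤ) : ℝ) *
      h (X (σ 0)) (X (σ 1)) (X (σ 2)) (X (σ 3)) (X (σ 4)) = 0 := by
  let τ : Equiv.Perm (Fin 5) := Equiv.swap 1 3 * Equiv.swap 2 4
  have hτ : Equiv.Perm.sign τ = 1 := by decide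
  have key := sum_sign_mul_comp_mul (fun Y => h (Y 0) (Y 1) (Y 2) (Y 3) (Y 4)) X τ
  have h0 : τ 0 = 0 := by decide
  have h1 : τ 1 = 3 := by decide
  have h2 : τ 2 = 4 := by decide
  have h3 : τ 3 = 1 := by decide
  have h4 : τ 4 = 2 := by decide
  simp only [Function.comp_apply, h0, h1, h2, h3, h4, hτ, Units.val_one, Int.cast_one,
    one_mul] at key
  have hneg (σ : Equiv.Perm (Fin 5)) := hpair (X (σ 0)) (X (σ 3)) (X (σ 4)) (X (σ 1)) (X (σ 2))
  simp only [hneg, mul_neg, Finset.sum_neg_distrib] at key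
  linarith

/-- The ε-dimension-1 Bianchi identity `f_{[ABC]DE} = f_{[AB|}{}^F f_{F|C]DE}` of the
Polaček–Siegel construction implies the quadratic constraint
`f_{[AB|}{}^F f_{F|CDE]} = 0`: if `g` is antisymmetric in its first two arguments,
`h(A,B,C,D,E) = −h(A,D,E,B,C)`, and the antisymmetrization over `(A,B,C)` of
`h(A,B,C,D,E)` equals the antisymmetrization over `(A,B,C)` of
`Σ_F g(A,B,F) k(F,C,D,E)`, then the total antisymmetrization over all five indices of
`Σ_F g(A,B,F) k(F,C,D,E)` vanishes. -/
theorem bianchi_implies_quadratic_constraint {ι : Type*} [Fintype ι]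
    (g : ι → ι → ι → ℝ) (hg : ∀ A B F, g A B F = -g B A F)
    (k : ι → ι → ι → ι → ℝ)
    (h : ι → ι → ι → ι → ι → ℝ)
    (hpair : ∀ A B C D E, h A B C D E = -h A D E B C)
    (hbianchi : ∀ A B C D E : ι,
      (∑ σ : Equiv.Perm (Fin 3), ((Equiv.Perm.sign σ : ℤ) : ℝ) *
          h (![A, B, C] (σ 0)) (![A, B, C] (σ 1)) (![A, B, C] (σ 2)) D E)
        = ∑ σ : Equiv.Perm (Fin 3), ((Equiv.Perm.sign σ : ℤ) : ℝ) *
            ∑ F, g (![A, B, C] (σ 0)) (![A, B, C] (σ 1)) F *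
              k F (![A, B, C] (σ 2)) D E) :
    ∀ X : Fin 5 → ι,
      ∑ σ : Equiv.Perm (Fin 5), ((Equiv.Perm.sign σ : ℤ) : ℝ) *
        ∑ F, g (X (σ 0)) (X (σ 1)) F * k F (X (σ 2)) (X (σ 3)) (X (σ 4)) = 0 := by
  intro X
  have hT := sum_sign_mul_sum_sign_fin_three (fun A B C D E => ∑ F, g A B F * k F C D E) X
  simp only [← hbianchi] at hT
  rw [sum_sign_mul_sum_sign_fin_three, sum_sign_mul_eq_zero_of_pair_antisymm h hpair] at hT
  linarith
end
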